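/- The real scalar function u(x,t) = −2 Bᵀ F(x,t)⁻¹ Cᵀ is real-analytic on the entire (x,t)-plane, and for each fixed t ∈ ℝ it decays exponentially as x → ±∞, i.e. there exist constants M > 0 and ε > 0 (depending on t) with |u(x,t)| ≤ M e^{−ε|x|} for all x ∈ ℝ. -/

import Mathlib

open Matrix MeasureTheory Filter

noncomputable def mexp {p : ℕ} (M : Matrix (Fin p) (Fin p) ℝ) : Matrix (Fin p) (Fin p) ℝ :=
  ∑' k : ℕ, (k.factorial : ℝ)⁻¹ • M ^ k

def EigPos {p : ℕ} (A : Matrix (Fin p) (Fin p) ℝ) : Prop :=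
  ∀ μ ∈ spectrum ℂ (A.map Complex.ofReal), 0 < μ.re

def Observable {p : ℕ} (A : Matrix (Fin p) (Fin p) ℝ) (C : Matrix (Fin 1) (Fin p) ℝ) : Prop :=
  ∀ v : Fin p → ℝ, (∀ r : ℕ, (C * A ^ r) *ᵥ v = 0) → v = 0

def Controllable {p : ℕ} (A : Matrix (Fin p) (Fin p) ℝ) (B : Matrix (Fin p) (Fin 1) ℝ) : Prop :=
  ∀ v : Fin p → ℝ, (∀ r : ℕ, (Bᵀ * Aᵀ ^ r) *ᵥ v = 0) → v = 0

noncomputable def Qmat {p : ℕ} (A : Matrix (Fin p) (Fin p) ℝ) (C : Matrix (Fin 1) (Fin p) ℝ) :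
    Matrix (Fin p) (Fin p) ℝ :=
  Matrix.of fun i j =>
    ∫ s in Set.Ioi (0 : ℝ), (mexp (-(s • Aᵀ)) * (Cᵀ * C) * mexp (-(s • A))) i j

noncomputable def Nmat {p : ℕ} (A : Matrix (Fin p) (Fin p) ℝ) (B : Matrix (Fin p) (Fin 1) ℝ) :
    Matrix (Fin p) (Fin p) ℝ :=
  Matrix.of fun i j =>
    ∫ s in Set.Ioi (0 : ℝ), (mexp (-(s • A)) * (B * Bᵀ) * mexp (-(s • Aᵀ))) i j

noncomputable def Pmat {p : ℕ} (A : Matrix (Fin p) (Fin p) ℝ) (B : Matrix (Fin p) (Fin 1) ℝ)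
    (C : Matrix (Fin 1) (Fin p) ℝ) : Matrix (Fin p) (Fin p) ℝ :=
  Matrix.of fun i j =>
    ∫ s in Set.Ioi (0 : ℝ), (mexp (-(s • A)) * (B * C) * mexp (-(s • A))) i j

noncomputable def Fmat {p : ℕ} (A : Matrix (Fin p) (Fin p) ℝ) (B : Matrix (Fin p) (Fin 1) ℝ)
    (C : Matrix (Fin 1) (Fin p) ℝ) (x t : ℝ) : Matrix (Fin p) (Fin p) ℝ :=
  mexp ((2 * x) • Aᵀ - (8 * t) • Aᵀ ^ 3) +
    Qmat A C * mexp (-((2 * x) • A) + (8 * t) • A ^ 3) * Nmat A B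

noncomputable def Emat {p : ℕ} (A : Matrix (Fin p) (Fin p) ℝ) (B : Matrix (Fin p) (Fin 1) ℝ)
    (C : Matrix (Fin 1) (Fin p) ℝ) (x t : ℝ) : Matrix (Fin p) (Fin p) ℝ :=
  mexp ((2 * x) • A - (8 * t) • A ^ 3) +
    Pmat A B C * mexp (-((2 * x) • A) + (8 * t) • A ^ 3) * Pmat A B C

noncomputable def uFun {p : ℕ} (A : Matrix (Fin p) (Fin p) ℝ) (B : Matrix (Fin p) (Fin 1) ℝ)
    (C : Matrix (Fin 1) (Fin p) ℝ) (x t : ℝ) : ℝ :=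
  -2 * ((Bᵀ * (Fmat A B C x t)⁻¹ * Cᵀ : Matrix (Fin 1) (Fin 1) ℝ) 0 0)

noncomputable def vFun {p : ℕ} (A : Matrix (Fin p) (Fin p) ℝ) (B : Matrix (Fin p) (Fin 1) ℝ)
    (C : Matrix (Fin 1) (Fin p) ℝ) (x t : ℝ) : ℝ :=
  -2 * ((C * (Emat A B C x t)⁻¹ * B : Matrix (Fin 1) (Fin 1) ℝ) 0 0)

noncomputable def calQ {p : ℕ} (A : Matrix (Fin p) (Fin p) ℝ) (C : Matrix (Fin 1) (Fin p) ℝ)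
    (x t : ℝ) : Matrix (Fin p) (Fin p) ℝ :=
  mexp (-(x • Aᵀ)) * mexp ((8 * t) • Aᵀ ^ 3) * Qmat A C * mexp (-(x • A)) * mexp ((8 * t) • A ^ 3)

noncomputable def calN {p : ℕ} (A : Matrix (Fin p) (Fin p) ℝ) (B : Matrix (Fin p) (Fin 1) ℝ)
    (x : ℝ) : Matrix (Fin p) (Fin p) ℝ :=
  mexp (-(x • A)) * Nmat A B * mexp (-(x • Aᵀ))

noncomputable def Gam {p : ℕ} (A : Matrix (Fin p) (Fin p) ℝ) (B : Matrix (Fin p) (Fin 1) ℝ)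
    (C : Matrix (Fin 1) (Fin p) ℝ) (x t : ℝ) : Matrix (Fin p) (Fin p) ℝ :=
  1 + calQ A C x t * calN A B x

noncomputable def Om {p : ℕ} (A : Matrix (Fin p) (Fin p) ℝ) (B : Matrix (Fin p) (Fin 1) ℝ)
    (C : Matrix (Fin 1) (Fin p) ℝ) (w t : ℝ) : ℝ :=
  ((C * mexp (-(w • A)) * mexp ((8 * t) • A ^ 3) * B : Matrix (Fin 1) (Fin 1) ℝ) 0 0)

noncomputable def Kker {p : ℕ} (A : Matrix (Fin p) (Fin p) ℝ) (B : Matrix (Fin p) (Fin 1) ℝ)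
    (C : Matrix (Fin 1) (Fin p) ℝ) (x y t : ℝ) : ℝ :=
  ((Bᵀ * (Fmat A B C x t)⁻¹ * mexp (-((y - x) • Aᵀ)) * Cᵀ : Matrix (Fin 1) (Fin 1) ℝ) 0 0)

open scoped Matrix.Norms.Operator

lemma mexp_eq {p : ℕ} (M : Matrix (Fin p) (Fin p) ℝ) : mexp M = NormedSpace.exp M := by
  rw [NormedSpace.exp_eq_tsum ℝ]; rfl

lemma exp_eigvec {p : ℕ} (M : Matrix (Fin p) (Fin p) ℂ) (μ : ℂ) (v : Fin p → ℂ)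
    (h : M *ᵥ v = μ • v) : NormedSpace.exp M *ᵥ v = Complex.exp μ • v := by
  have h1 := NormedSpace.exp_series_hasSum_exp' (𝕂 := ℂ) M
  let L : Matrix (Fin p) (Fin p) ℂ →ₗ[ℂ] (Fin p → ℂ) :=
    { toFun := fun M => M *ᵥ v
      map_add' := fun a b => Matrix.add_mulVec a b v
      map_smul' := fun a b => Matrix.smul_mulVec a b v }
  have hL : Continuous L := L.continuous_of_finiteDimensional
  have h2 := h1.map L hL
  have h3 := (NormedSpace.exp_series_hasSum_exp' (𝕂 := ℂ) μ).smul_const v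
  have hp : ∀ n : ℕ, M ^ n *ᵥ v = μ ^ n • v := by
    intro n
    induction n with
    | zero => simp
    | succ n ih => rw [pow_succ, ← Matrix.mulVec_mulVec, h, Matrix.mulVec_smul, ih, smul_smul, pow_succ, mul_comm]
  rw [Complex.exp_eq_exp_ℂ]
  refine h2.unique ?_
  convert! h3 using 1
  ext1 n
  show ((n.factorial : ℂ)⁻¹ • M ^ n) *ᵥ v = _
  rw [Matrix.smul_mulVec, hp, smul_smul, smul_eq_mul]

lemma spec_exp {p : ℕ} (hp : 0 < p) (M : Matrix (Fin p) (Fin p) ℂ) (z : ℂ)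
    (hz : z ∈ spectrum ℂ (NormedSpace.exp M)) : ∃ μ ∈ spectrum ℂ M, z = Complex.exp μ := by
  have : Nonempty (Fin p) := ⟨⟨0, hp⟩⟩
  have hmem : NormedSpace.exp M ∈ Algebra.adjoin ℂ {M} := by
    have hc : IsClosed ((Algebra.adjoin ℂ {M} : Subalgebra ℂ _) : Set (Matrix (Fin p) (Fin p) ℂ)) :=
      Submodule.closed_of_finiteDimensional (Subalgebra.toSubmodule (Algebra.adjoin ℂ {M}))
    exact NormedSpace.exp_mem (s := Algebra.adjoin ℂ {M}) hc (Algebra.self_mem_adjoin_singleton ℂ M)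
  rw [Algebra.adjoin_singleton_eq_range_aeval] at hmem
  obtain ⟨q, hq⟩ := hmem
  have hq' : Polynomial.aeval M q = NormedSpace.exp M := hq
  rw [← hq', spectrum.map_polynomial_aeval] at hz
  obtain ⟨μ, hμ, rfl⟩ := hz
  refine ⟨μ, hμ, ?_⟩
  rw [← Matrix.spectrum_toLin', ← Module.End.hasEigenvalue_iff_mem_spectrum] at hμ
  obtain ⟨v, hv⟩ := hμ.exists_hasEigenvector
  have h1 : M *ᵥ v = μ • v := by simpa using hv.apply_eq_smul
  have h2 := Module.End.aeval_apply_of_hasEigenvector (p := q) hv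
  have h3 : Polynomial.aeval (Matrix.toLin' M) q = Matrix.toLin' (Polynomial.aeval M q) := by
    have := Polynomial.aeval_algHom_apply (Matrix.toLinAlgEquiv' (R := ℂ) (n := Fin p)).toAlgHom M q
    exact this
  rw [h3, Matrix.toLin'_apply, hq', exp_eigvec M μ v h1] at h2
  exact (smul_left_injective ℂ hv.2 h2).symm

lemma pow_decay {p : ℕ} (hp : 0 < p) (M : Matrix (Fin p) (Fin p) ℂ)
    (h : ∀ μ ∈ spectrum ℂ M, 0 < μ.re) :
    ∃ r : ℝ, 0 < r ∧ r < 1 ∧ ∃ n0 : ℕ, ∀ n ≥ n0, ‖NormedSpace.exp (-M) ^ n‖ ≤ r ^ n := by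
  have : Nonempty (Fin p) := ⟨⟨0, hp⟩⟩
  have h1 : spectralRadius ℂ (NormedSpace.exp (-M)) < ((1 : NNReal) : ENNReal) := by
    apply spectrum.spectralRadius_lt_of_forall_lt
    intro z hz
    obtain ⟨μ, hμ, rfl⟩ := spec_exp hp _ z hz
    rw [← spectrum.neg_eq, Set.mem_neg] at hμ
    have := h _ hμ
    rw [← NNReal.coe_lt_coe, coe_nnnorm, Complex.norm_exp]
    simp at this ⊢
    exact this
  obtain ⟨r, hr1, hr2⟩ := ENNReal.lt_iff_exists_nnreal_btwn.1 h1
  have h2 := spectrum.pow_nnnorm_pow_one_div_tendsto_nhds_spectralRadius (NormedSpace.exp (-M))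
  have h3 := (h2.eventually (gt_mem_nhds hr1)).and (eventually_gt_atTop 0)
  obtain ⟨n0, hn0⟩ := eventually_atTop.1 h3
  refine ⟨r, ?_, ?_, n0, ?_⟩
  · have := (zero_le).trans_lt hr1
    exact_mod_cast this
  · exact_mod_cast hr2
  · intro n hn
    obtain ⟨h4, h5⟩ := hn0 n hn
    have h6 := ENNReal.rpow_le_rpow h4.le (Nat.cast_nonneg n : (0:ℝ) ≤ n)
    rw [← ENNReal.rpow_mul, one_div, inv_mul_cancel₀ (by positivity), ENNReal.rpow_one,
      ENNReal.rpow_natCast] at h6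
    exact_mod_cast h6

lemma decay {p : ℕ} (hp : 0 < p) (A : Matrix (Fin p) (Fin p) ℝ) (hA : EigPos A) :
    ∃ K > (0:ℝ), ∃ ε > (0:ℝ), ∀ s : ℝ, 0 ≤ s →
      ‖NormedSpace.exp (-(s • A))‖ ≤ K * Real.exp (-ε * s) := by
  obtain ⟨r, hr0, hr1, n0, hn0⟩ := pow_decay hp _ hA
  have key : ∀ n ≥ n0, ‖NormedSpace.exp (-A) ^ n‖ ≤ r ^ n := by
    intro n hn
    have h1 := hn0 n hn
    have h2 : (NormedSpace.exp (-A) ^ n).map Complex.ofReal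
        = NormedSpace.exp (-(A.map Complex.ofReal)) ^ n := by
      have hc : Continuous (Complex.ofRealHom.mapMatrix : Matrix (Fin p) (Fin p) ℝ →+* _) :=
        Continuous.matrix_map continuous_id Complex.continuous_ofReal
      have h3 := NormedSpace.map_exp (Complex.ofRealHom.mapMatrix :
        Matrix (Fin p) (Fin p) ℝ →+* Matrix (Fin p) (Fin p) ℂ) hc (-A)
      have h4 := map_pow (Complex.ofRealHom.mapMatrix :
        Matrix (Fin p) (Fin p) ℝ →+* Matrix (Fin p) (Fin p) ℂ) (NormedSpace.exp (-A)) n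
      refine h4.trans (congrArg (· ^ n) (h3.trans ?_))
      rw [map_neg]
      rfl
    rw [← h2] at h1
    refine le_trans (le_of_eq ?_) h1
    rw [Matrix.linfty_opNorm_def, Matrix.linfty_opNorm_def]
    simp
  obtain ⟨K1, hK1⟩ := (isCompact_Icc (a := (0:ℝ)) (b := 1 + n0)).exists_bound_of_continuousOn
    (f := fun s : ℝ => NormedSpace.exp (-(s • A)))
    (NormedSpace.exp_continuous.comp (by fun_prop)).continuousOn
  have hK0 : 0 ≤ K1 := (norm_nonneg _).trans (hK1 0 (by constructor <;> [simp; positivity]))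
  set ε := -Real.log r with hε
  have hε0 : 0 < ε := by have := Real.log_neg hr0 hr1; linarith
  refine ⟨(K1 + 1) * Real.exp (ε * (1 + n0)), by positivity, ε, hε0, ?_⟩
  intro s hs
  have hre : ∀ n : ℕ, r ^ n = Real.exp (-ε * n) := by
    intro n
    rw [hε, neg_neg, mul_comm, Real.exp_nat_mul, Real.exp_log hr0]
  rw [mul_assoc, ← Real.exp_add]
  by_cases hsn : s ≤ 1 + n0
  · refine (hK1 s ⟨hs, hsn⟩).trans ?_
    have : 1 ≤ Real.exp (ε * (1 + n0) + -ε * s) := by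
      apply Real.one_le_exp; nlinarith
    nlinarith
  · push Not at hsn
    set n := ⌊s⌋₊ with hn
    have h1 : (n : ℝ) ≤ s := Nat.floor_le hs
    have h2 : s < n + 1 := Nat.lt_floor_add_one s
    have h3 : n0 ≤ n := by
      have : (n0 : ℝ) < n := by linarith
      exact_mod_cast this.le
    have h4 : -(s • A) = -((s - n) • A) + n • (-A) := by
      rw [sub_smul, Nat.cast_smul_eq_nsmul]; simp; abel
    have h5 : NormedSpace.exp (-(s • A)) = NormedSpace.exp (-((s-n) • A)) * NormedSpace.exp (-A) ^ n := by
      rw [h4, Matrix.exp_add_of_commute, Matrix.exp_nsmul]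
      exact ((((Commute.refl A).smul_left _).neg_left).neg_right).smul_right n
    rw [h5]
    calc _ ≤ K1 * Real.exp (-ε * n) := by
          refine (norm_mul_le _ _).trans ?_
          rw [← hre]
          exact mul_le_mul (hK1 _ ⟨by linarith, by
            have : (0:ℝ) ≤ n0 := Nat.cast_nonneg _
            linarith⟩) (key n h3) (norm_nonneg _) hK0
      _ ≤ (K1 + 1) * Real.exp (ε * (1 + n0) + -ε * s) := by
          have hh : (0:ℝ) ≤ n0 := Nat.cast_nonneg _
          gcongr
          · linarith
          · nlinarith

lemma entry_le {p : ℕ} (M : Matrix (Fin p) (Fin p) ℝ) (i j : Fin p) : |M i j| ≤ ‖M‖ := by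
  have h1 : ‖M i j‖₊ ≤ ∑ j, ‖M i j‖₊ :=
    Finset.single_le_sum (f := fun j => ‖M i j‖₊) (fun _ _ => zero_le) (Finset.mem_univ j)
  have h2 : ∑ j, ‖M i j‖₊ ≤ ‖M‖₊ := by
    rw [Matrix.linfty_opNNNorm_def]
    exact Finset.le_sup (f := fun i => ∑ j, ‖M i j‖₊) (Finset.mem_univ i)
  exact_mod_cast h1.trans h2

lemma EigPos.transpose {p : ℕ} {A : Matrix (Fin p) (Fin p) ℝ} (hA : EigPos A) : EigPos Aᵀ := by
  intro μ hμ
  apply hA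
  rw [Matrix.transpose_map, Matrix.mem_spectrum_iff_isRoot_charpoly,
    Matrix.charpoly_transpose] at hμ
  rwa [Matrix.mem_spectrum_iff_isRoot_charpoly]

lemma cont_exp {p : ℕ} (A : Matrix (Fin p) (Fin p) ℝ) :
    Continuous (fun s : ℝ => NormedSpace.exp (-(s • A))) :=
  NormedSpace.exp_continuous.comp (by fun_prop)

lemma Q_integrable {p : ℕ} (hp : 0 < p) (A : Matrix (Fin p) (Fin p) ℝ)
    (C : Matrix (Fin 1) (Fin p) ℝ) (hA : EigPos A) (i j : Fin p) :
    IntegrableOn (fun s : ℝ => (NormedSpace.exp (-(s • Aᵀ)) * (Cᵀ * C) *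
      NormedSpace.exp (-(s • A))) i j) (Set.Ioi 0) := by
  obtain ⟨K, hK, ε, hε, h1⟩ := decay hp A hA
  obtain ⟨K', hK', ε', hε', h2⟩ := decay hp Aᵀ hA.transpose
  apply integrable_of_isBigO_exp_neg (b := ε' + ε) (by positivity)
  · apply Continuous.continuousOn
    have := ((cont_exp Aᵀ).mul (continuous_const (y := Cᵀ * C))).mul (cont_exp A)
    exact this.matrix_elem i j
  · apply Asymptotics.IsBigO.of_bound (K' * ‖Cᵀ * C‖ * K)
    filter_upwards [eventually_ge_atTop 0] with s hs
    rw [Real.norm_eq_abs, Real.norm_eq_abs, Real.abs_exp]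
    refine (entry_le _ i j).trans ?_
    calc _ ≤ ‖NormedSpace.exp (-(s • Aᵀ))‖ * ‖Cᵀ * C‖ * ‖NormedSpace.exp (-(s • A))‖ :=
          (norm_mul_le _ _).trans (mul_le_mul_of_nonneg_right (norm_mul_le _ _) (norm_nonneg _))
      _ ≤ (K' * Real.exp (-ε' * s)) * ‖Cᵀ * C‖ * (K * Real.exp (-ε * s)) := by
          gcongr
          · exact h2 s hs
          · exact h1 s hs
      _ = _ := by
          rw [show -(ε' + ε) * s = -ε' * s + -ε * s by ring, Real.exp_add]; ring

lemma form_eq {p : ℕ} (E : Matrix (Fin p) (Fin p) ℝ) (C : Matrix (Fin 1) (Fin p) ℝ)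
    (v : Fin p → ℝ) :
    v ⬝ᵥ ((Eᵀ * (Cᵀ * C) * E) *ᵥ v) = (((C * E) *ᵥ v) 0) ^ 2 := by
  have h : Eᵀ * (Cᵀ * C) * E = (C * E)ᵀ * (C * E) := by
    rw [Matrix.transpose_mul]; simp only [Matrix.mul_assoc]
  rw [h, ← Matrix.mulVec_mulVec, Matrix.dotProduct_mulVec, Matrix.vecMul_transpose]
  simp [dotProduct, sq]

lemma Q_form {p : ℕ} (hp : 0 < p) (A : Matrix (Fin p) (Fin p) ℝ)
    (C : Matrix (Fin 1) (Fin p) ℝ) (hA : EigPos A) (v : Fin p → ℝ) :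
    IntegrableOn (fun s : ℝ => (((C * NormedSpace.exp (-(s • A))) *ᵥ v) 0) ^ 2) (Set.Ioi 0) ∧
    v ⬝ᵥ (Qmat A C *ᵥ v) =
      ∫ s in Set.Ioi (0:ℝ), (((C * NormedSpace.exp (-(s • A))) *ᵥ v) 0) ^ 2 := by
  have h1 : ∀ s : ℝ, (((C * NormedSpace.exp (-(s • A))) *ᵥ v) 0) ^ 2 =
      ∑ i, ∑ j, v i * ((NormedSpace.exp (-(s • Aᵀ)) * (Cᵀ * C) *
      NormedSpace.exp (-(s • A))) i j * v j) := by
    intro s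
    rw [← form_eq, ← Matrix.exp_transpose, Matrix.transpose_neg, Matrix.transpose_smul]
    simp only [dotProduct, Matrix.mulVec, Finset.mul_sum]
  have hi : ∀ i j, IntegrableOn (fun s : ℝ => v i * ((NormedSpace.exp (-(s • Aᵀ)) * (Cᵀ * C) *
      NormedSpace.exp (-(s • A))) i j * v j)) (Set.Ioi 0) := fun i j =>
    ((Q_integrable hp A C hA i j).mul_const _).const_mul _
  simp_rw [h1]
  constructor
  · exact integrable_finsetSum _ fun i _ => integrable_finsetSum _ fun j _ => hi i j
  · rw [integral_finsetSum _ fun i _ => integrable_finsetSum _ fun j _ => hi i j]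
    simp only [dotProduct, Matrix.mulVec, Finset.mul_sum]
    refine Finset.sum_congr rfl fun i _ => ?_
    rw [integral_finsetSum _ fun j _ => hi i j]
    refine Finset.sum_congr rfl fun j _ => ?_
    rw [integral_const_mul, integral_mul_const]
    simp only [Qmat, Matrix.of_apply, mexp_eq]

lemma g_deriv {p : ℕ} (A : Matrix (Fin p) (Fin p) ℝ)
    (C : Matrix (Fin 1) (Fin p) ℝ) (v : Fin p → ℝ) (r : ℕ) (s : ℝ) :
    HasDerivAt (fun s : ℝ => ((C * A ^ r * NormedSpace.exp (-(s • A))) *ᵥ v) 0)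
      (-(((C * A ^ (r + 1) * NormedSpace.exp (-(s • A))) *ᵥ v) 0)) s := by
  let L : Matrix (Fin p) (Fin p) ℝ →ₗ[ℝ] ℝ :=
    { toFun := fun M => ((C * A ^ r * M) *ᵥ v) 0
      map_add' := fun a b => by rw [Matrix.mul_add, Matrix.add_mulVec]; rfl
      map_smul' := fun a b => by rw [Matrix.mul_smul, Matrix.smul_mulVec]; rfl }
  have h1 := hasDerivAt_exp_smul_const' (𝕂 := ℝ) (-A) s
  have h2 := (LinearMap.toContinuousLinearMap L).hasFDerivAt.comp_hasDerivAt s h1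
  have e : ∀ s : ℝ, s • (-A) = -(s • A) := fun s => smul_neg s A
  convert! h2 using 1
  · ext s
    show _ = ((C * A ^ r * NormedSpace.exp (s • (-A))) *ᵥ v) 0
    rw [e]
  · show _ = ((C * A ^ r * ((-A) * NormedSpace.exp (s • (-A)))) *ᵥ v) 0
    rw [e, pow_succ, Matrix.neg_mul, Matrix.mul_neg, Matrix.neg_mulVec, Pi.neg_apply]
    simp only [Matrix.mul_assoc]

lemma Q_pos {p : ℕ} (hp : 0 < p) (A : Matrix (Fin p) (Fin p) ℝ)
    (C : Matrix (Fin 1) (Fin p) ℝ) (hA : EigPos A) (hobs : Observable A C) (v : Fin p → ℝ) :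
    0 ≤ v ⬝ᵥ (Qmat A C *ᵥ v) ∧ (v ⬝ᵥ (Qmat A C *ᵥ v) = 0 → v = 0) := by
  obtain ⟨hi, he⟩ := Q_form hp A C hA v
  rw [he]
  refine ⟨integral_nonneg fun s => sq_nonneg _, fun h0 => ?_⟩
  have h0r : ∀ s : ℝ, ((C * NormedSpace.exp (-(s • A))) *ᵥ v) 0
      = ((C * A ^ 0 * NormedSpace.exp (-(s • A))) *ᵥ v) 0 := by intro s; simp
  have hcont : Continuous fun s : ℝ => ((C * NormedSpace.exp (-(s • A))) *ᵥ v) 0 := by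
    simp_rw [h0r]
    exact continuous_iff_continuousAt.2 fun s => (g_deriv A C v 0 s).continuousAt
  rw [setIntegral_eq_zero_iff_of_nonneg_ae (Eventually.of_forall fun s => sq_nonneg _) hi] at h0
  have hz := Measure.eqOn_open_of_ae_eq h0 isOpen_Ioi (hcont.pow 2).continuousOn continuousOn_const
  have hall : ∀ r : ℕ, ∀ s > (0:ℝ), ((C * A ^ r * NormedSpace.exp (-(s • A))) *ᵥ v) 0 = 0 := by
    intro r
    induction r with
    | zero =>
      intro s hs
      rw [← h0r]
      have := hz hs
      simpa using this
    | succ r ih =>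
      intro s hs
      have h1 := g_deriv A C v r s
      have h2 : HasDerivAt (fun s : ℝ => ((C * A ^ r * NormedSpace.exp (-(s • A))) *ᵥ v) 0) 0 s := by
        refine (hasDerivAt_const s (0:ℝ)).congr_of_eventuallyEq ?_
        filter_upwards [Ioi_mem_nhds hs] with y hy using ih y hy
      have := h1.unique h2
      linarith
  have h1 : NormedSpace.exp (-((1:ℝ) • A)) *ᵥ v = 0 := by
    apply hobs
    intro r
    rw [Matrix.mulVec_mulVec]
    ext i
    rw [Subsingleton.elim i 0]
    exact hall r 1 one_pos
  have hu := Matrix.isUnit_exp (-((1:ℝ) • A))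
  exact Matrix.mulVec_injective_of_isUnit hu (by rw [h1, Matrix.mulVec_zero])

lemma isUnit_of_ker {p : ℕ} (M : Matrix (Fin p) (Fin p) ℝ) (h : ∀ v, M *ᵥ v = 0 → v = 0) :
    IsUnit M := by
  rw [← Matrix.mulVec_injective_iff_isUnit]
  intro a b hab
  have := h (a - b) (by rw [Matrix.mulVec_sub]; exact sub_eq_zero.2 hab)
  exact sub_eq_zero.1 this

lemma Nmat_eq {p : ℕ} (A : Matrix (Fin p) (Fin p) ℝ) (B : Matrix (Fin p) (Fin 1) ℝ) :
    Nmat A B = Qmat Aᵀ Bᵀ := by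
  simp [Nmat, Qmat]

lemma F_eq {p : ℕ} (A : Matrix (Fin p) (Fin p) ℝ) (B : Matrix (Fin p) (Fin 1) ℝ)
    (C : Matrix (Fin 1) (Fin p) ℝ) (x t : ℝ) :
    Fmat A B C x t = NormedSpace.exp ((2 * x) • Aᵀ - (8 * t) • Aᵀ ^ 3) +
      Qmat A C * NormedSpace.exp (-((2 * x) • A - (8 * t) • A ^ 3)) * Nmat A B := by
  rw [Fmat, mexp_eq, mexp_eq]
  congr 4
  abel

lemma F_unit {p : ℕ} (hp : 0 < p) (A : Matrix (Fin p) (Fin p) ℝ)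
    (B : Matrix (Fin p) (Fin 1) ℝ) (C : Matrix (Fin 1) (Fin p) ℝ)
    (hA : EigPos A) (hobs : Observable A C) (hctrl : Controllable A B) (x t : ℝ) :
    IsUnit (Fmat A B C x t) := by
  apply isUnit_of_ker
  intro v hv
  rw [F_eq] at hv
  set T := (2 * x) • A - (8 * t) • A ^ 3 with hT
  have hTt : (2 * x) • Aᵀ - (8 * t) • Aᵀ ^ 3 = Tᵀ := by
    simp [hT, Matrix.transpose_pow]
  rw [hTt, Matrix.add_mulVec, ← Matrix.mulVec_mulVec, ← Matrix.mulVec_mulVec] at hv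
  set w := NormedSpace.exp (-T) *ᵥ (Nmat A B *ᵥ v) with hw
  have h1 := (Q_pos hp A C hA hobs w).1
  have h2 := Q_pos hp Aᵀ Bᵀ hA.transpose hctrl v
  rw [← Nmat_eq] at h2
  have h3 : w ⬝ᵥ (NormedSpace.exp Tᵀ *ᵥ v) = v ⬝ᵥ (Nmat A B *ᵥ v) := by
    rw [Matrix.exp_transpose, Matrix.dotProduct_mulVec, Matrix.vecMul_transpose, hw,
      Matrix.mulVec_mulVec, Matrix.exp_neg,
      Matrix.mul_nonsing_inv _ ((Matrix.isUnit_iff_isUnit_det _).1 (Matrix.isUnit_exp T)),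
      Matrix.one_mulVec, dotProduct_comm]
  have h4 : w ⬝ᵥ (NormedSpace.exp Tᵀ *ᵥ v) + w ⬝ᵥ (Qmat A C *ᵥ w) = 0 := by
    rw [← dotProduct_add, hv, dotProduct_zero]
  apply h2.2
  linarith [h2.1]

lemma half_decay {p : ℕ} (hp : 0 < p) (A S Q N : Matrix (Fin p) (Fin p) ℝ) (hA : EigPos A)
    (hS : Commute A S) :
    ∃ X : ℝ, 0 ≤ X ∧ ∃ M : ℝ, 0 ≤ M ∧ ∃ ε > (0:ℝ), ∀ x ≥ X, ∀ G : Matrix (Fin p) (Fin p) ℝ,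
      (NormedSpace.exp ((2 * x) • A - S) + Q * NormedSpace.exp (-((2 * x) • A - S)ᵀ) * N) * G = 1 →
      ‖G‖ ≤ M * Real.exp (-ε * x) := by
  obtain ⟨K, hK, ε, hε, hd⟩ := decay hp A hA
  let E : ℝ → Matrix (Fin p) (Fin p) ℝ := fun x => NormedSpace.exp (-((2 * x) • A - S))
  have hE : ∀ x ≥ 0, ‖E x‖ ≤ (K * ‖NormedSpace.exp S‖) * Real.exp (-(2 * ε) * x) := by
    intro x hx
    have h1 : E x = NormedSpace.exp (-((2 * x) • A)) * NormedSpace.exp S := by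
      show NormedSpace.exp _ = _
      rw [← Matrix.exp_add_of_commute _ _ ((hS.smul_left _).neg_left)]
      congr 1; abel
    rw [h1]
    refine (norm_mul_le _ _).trans ?_
    have := hd (2 * x) (by positivity)
    calc _ ≤ (K * Real.exp (-ε * (2 * x))) * ‖NormedSpace.exp S‖ := by gcongr
      _ = _ := by rw [show -ε * (2 * x) = -(2 * ε) * x by ring]; ring
  have hE0 : Tendsto E atTop (nhds 0) := by
    apply squeeze_zero_norm' (a := fun x => (K * ‖NormedSpace.exp S‖) * Real.exp (-(2 * ε) * x))
    · filter_upwards [eventually_ge_atTop 0] with x hx using hE x hx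
    · have h1 : Tendsto (fun x : ℝ => Real.exp (-(2 * ε) * x)) atTop (nhds 0) :=
        Real.tendsto_exp_atBot.comp (tendsto_id.const_mul_atTop_of_neg (by linarith))
      simpa using h1.const_mul (K * ‖NormedSpace.exp S‖)
  have hEt : Tendsto (fun x => (E x)ᵀ) atTop (nhds 0) := by
    have h1 : Continuous (fun M : Matrix (Fin p) (Fin p) ℝ => Mᵀ) := continuous_id.matrix_transpose
    have := (h1.tendsto 0).comp hE0
    rw [Matrix.transpose_zero] at this
    exact this
  have hZ : Tendsto (fun x => E x * Q * (E x)ᵀ * N) atTop (nhds 0) := by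
    simpa using ((hE0.mul_const Q).mul hEt).mul_const N
  have hZn := hZ.norm
  rw [norm_zero] at hZn
  have hZ' := hZn.eventually_le_const (by norm_num : (0:ℝ) < 1 / 2)
  obtain ⟨X, hX⟩ := eventually_atTop.1 hZ'
  refine ⟨max X 0, le_max_right _ _, 2 * (K * ‖NormedSpace.exp S‖), by positivity, 2 * ε,
    by positivity, ?_⟩
  intro x hx G hG
  have hx0 : 0 ≤ x := (le_max_right _ _).trans hx
  have hx1 := hX x ((le_max_left _ _).trans hx)
  have hinv : E x * NormedSpace.exp ((2 * x) • A - S) = 1 := by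
    show NormedSpace.exp _ * _ = _
    rw [Matrix.exp_neg]
    exact Matrix.nonsing_inv_mul _ ((Matrix.isUnit_iff_isUnit_det _).1 (Matrix.isUnit_exp _))
  have hEt' : NormedSpace.exp (-((2 * x) • A - S)ᵀ) = (E x)ᵀ := by
    rw [← Matrix.transpose_neg, Matrix.exp_transpose]
  have h2 : G + (E x * Q * (E x)ᵀ * N) * G = E x := by
    have h3 := congrArg (fun Y => E x * Y) hG
    simp only [hEt', Matrix.mul_one] at h3
    refine Eq.trans ?_ h3
    rw [← Matrix.mul_assoc, Matrix.mul_add, hinv, Matrix.add_mul, Matrix.one_mul]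
    simp only [Matrix.mul_assoc]
  have h4 : ‖G‖ ≤ ‖E x‖ + ‖E x * Q * (E x)ᵀ * N‖ * ‖G‖ := by
    calc ‖G‖ = ‖E x - (E x * Q * (E x)ᵀ * N) * G‖ := by
          congr 1; exact eq_sub_of_add_eq h2
      _ ≤ ‖E x‖ + ‖(E x * Q * (E x)ᵀ * N) * G‖ := norm_sub_le _ _
      _ ≤ _ := by gcongr; exact norm_mul_le _ _
  have h5 : ‖E x * Q * (E x)ᵀ * N‖ * ‖G‖ ≤ 1 / 2 * ‖G‖ := by gcongr
  have h6 := hE x hx0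
  linarith

noncomputable def phi {p : ℕ} (B : Matrix (Fin p) (Fin 1) ℝ) (C : Matrix (Fin 1) (Fin p) ℝ) :
    Matrix (Fin p) (Fin p) ℝ →L[ℝ] ℝ :=
  LinearMap.toContinuousLinearMap
    { toFun := fun M => -2 * ((Bᵀ * M * Cᵀ : Matrix (Fin 1) (Fin 1) ℝ) 0 0)
      map_add' := fun a b => by
        rw [Matrix.mul_add, Matrix.add_mul, Matrix.add_apply, mul_add]
      map_smul' := fun a b => by
        rw [Matrix.mul_smul, Matrix.smul_mul, Matrix.smul_apply, smul_eq_mul, RingHom.id_apply,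
          smul_eq_mul]
        ring }

lemma phi_bound {p : ℕ} (B : Matrix (Fin p) (Fin 1) ℝ) (C : Matrix (Fin 1) (Fin p) ℝ) :
    ∃ c : ℝ, 0 ≤ c ∧ ∀ M : Matrix (Fin p) (Fin p) ℝ, |phi B C M| ≤ c * ‖M‖ := by
  have h := fun M => (phi B C).le_opNorm M
  simp only [Real.norm_eq_abs] at h
  exact ⟨_, ContinuousLinearMap.opNorm_nonneg _, h⟩

lemma u_eq {p : ℕ} (A : Matrix (Fin p) (Fin p) ℝ) (B : Matrix (Fin p) (Fin 1) ℝ)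
    (C : Matrix (Fin 1) (Fin p) ℝ) (x t : ℝ) :
    uFun A B C x t = phi B C (Fmat A B C x t)⁻¹ := rfl

lemma u_analytic {p : ℕ} (hp : 0 < p) (A : Matrix (Fin p) (Fin p) ℝ)
    (B : Matrix (Fin p) (Fin 1) ℝ) (C : Matrix (Fin 1) (Fin p) ℝ)
    (hA : EigPos A) (hobs : Observable A C) (hctrl : Controllable A B) (z : ℝ × ℝ) :
    AnalyticAt ℝ (fun w : ℝ × ℝ => uFun A B C w.1 w.2) z := by
  have hx : AnalyticAt ℝ (fun w : ℝ × ℝ => w.1) z := analyticAt_fst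
  have ht : AnalyticAt ℝ (fun w : ℝ × ℝ => w.2) z := analyticAt_snd
  have hT : ∀ D D' : Matrix (Fin p) (Fin p) ℝ,
      AnalyticAt ℝ (fun w : ℝ × ℝ => (2 * w.1) • D - (8 * w.2) • D') z := fun D D' =>
    ((analyticAt_const.mul hx).smul analyticAt_const).sub
      ((analyticAt_const.mul ht).smul analyticAt_const)
  have he : ∀ f : ℝ × ℝ → Matrix (Fin p) (Fin p) ℝ, AnalyticAt ℝ f z →
      AnalyticAt ℝ (fun w => NormedSpace.exp (f w)) z := fun f hf =>
    (NormedSpace.exp_analytic (𝕂 := ℝ) (f z)).comp hf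
  have hF : AnalyticAt ℝ (fun w : ℝ × ℝ => Fmat A B C w.1 w.2) z := by
    simp_rw [F_eq]
    exact (he _ (hT _ _)).add ((analyticAt_const.mul (he _ (hT _ _).neg)).mul analyticAt_const)
  obtain ⟨U, hU⟩ := F_unit hp A B C hA hobs hctrl z.1 z.2
  have hI : AnalyticAt ℝ (fun w : ℝ × ℝ => (Fmat A B C w.1 w.2)⁻¹) z := by
    simp_rw [Matrix.nonsing_inv_eq_ringInverse]
    have h1 : AnalyticAt ℝ Ring.inverse (Fmat A B C z.1 z.2) := by
      rw [← hU]; exact analyticAt_inverse U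
    exact AnalyticAt.comp (f := fun w : ℝ × ℝ => Fmat A B C w.1 w.2) h1 hF
  simp_rw [u_eq]
  exact ((phi B C).analyticAt _).comp hI

lemma combine (u : ℝ → ℝ) (hc : Continuous u) {X Y M1 M2 ε1 ε2 : ℝ} (hX : 0 ≤ X) (hY : 0 ≤ Y)
    (hM1 : 0 ≤ M1) (hM2 : 0 ≤ M2) (h1 : 0 < ε1) (h2 : 0 < ε2)
    (hp : ∀ x ≥ X, |u x| ≤ M1 * Real.exp (-ε1 * x))
    (hn : ∀ x ≥ Y, |u (-x)| ≤ M2 * Real.exp (-ε2 * x)) :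
    ∃ M > (0 : ℝ), ∃ ε > (0 : ℝ), ∀ x : ℝ, |u x| ≤ M * Real.exp (-ε * |x|) := by
  obtain ⟨D, hD⟩ := (isCompact_Icc (a := -Y) (b := X)).exists_bound_of_continuousOn hc.continuousOn
  have hD0 : 0 ≤ D := (norm_nonneg _).trans (hD 0 ⟨by linarith, hX⟩)
  set ε := min ε1 ε2 with hε
  have hε0 : 0 < ε := lt_min h1 h2
  have e1 : ε ≤ ε1 := min_le_left _ _
  have e2 : ε ≤ ε2 := min_le_right _ _
  set D' := D * Real.exp (ε * (X + Y)) with hD'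
  have hD'0 : 0 ≤ D' := by positivity
  refine ⟨M1 + M2 + D' + 1, by positivity, ε, hε0, fun x => ?_⟩
  by_cases hx : X ≤ x
  · have a : |x| = x := abs_of_nonneg (hX.trans hx)
    rw [a]
    have := hX.trans hx
    refine (hp x hx).trans ?_
    gcongr
    linarith
  · by_cases hy : x ≤ -Y
    · have a : |x| = -x := abs_of_nonpos (by linarith)
      rw [a]
      have h := hn (-x) (by linarith)
      rw [neg_neg] at h
      have : 0 ≤ -x := by linarith
      refine h.trans ?_
      gcongr
      linarith
    · push Not at hx hy
      have h := hD x ⟨hy.le, hx.le⟩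
      rw [Real.norm_eq_abs] at h
      have ha : |x| ≤ X + Y := abs_le.2 ⟨by linarith, by linarith⟩
      calc |u x| ≤ D * 1 := by linarith
        _ ≤ D * (Real.exp (ε * (X + Y)) * Real.exp (-ε * |x|)) := by
          gcongr
          rw [← Real.exp_add]
          apply Real.one_le_exp
          nlinarith
        _ = D' * Real.exp (-ε * |x|) := by rw [hD']; ring
        _ ≤ _ := by gcongr; linarith

theorem statement5 {p : ℕ} (hp : 0 < p) (A : Matrix (Fin p) (Fin p) ℝ)
    (B : Matrix (Fin p) (Fin 1) ℝ) (C : Matrix (Fin 1) (Fin p) ℝ)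
    (hA : EigPos A) (hobs : Observable A C) (hctrl : Controllable A B) :
    (∀ z : ℝ × ℝ, AnalyticAt ℝ (fun w : ℝ × ℝ => uFun A B C w.1 w.2) z) ∧
    (∀ t : ℝ, ∃ M > (0 : ℝ), ∃ ε > (0 : ℝ),
      ∀ x : ℝ, |uFun A B C x t| ≤ M * Real.exp (-ε * |x|)) := by
  have han := u_analytic hp A B C hA hobs hctrl
  refine ⟨han, fun t => ?_⟩
  obtain ⟨c, hc0, hcb⟩ := phi_bound B C
  have hc : Continuous fun x => uFun A B C x t := by
    have h1 : Continuous (fun w : ℝ × ℝ => uFun A B C w.1 w.2) :=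
      continuous_iff_continuousAt.2 fun z => (han z).continuousAt
    have h2 : Continuous fun x : ℝ => (x, t) := by fun_prop
    have h3 := Continuous.comp (g := fun w : ℝ × ℝ => uFun A B C w.1 w.2)
      (f := fun x : ℝ => (x, t)) h1 h2
    simpa only [Function.comp_def] using h3
  have hFu : ∀ x, IsUnit (Fmat A B C x t).det := fun x =>
    (Matrix.isUnit_iff_isUnit_det _).1 (F_unit hp A B C hA hobs hctrl x t)
  have hQ : IsUnit (Qmat A C).det := (Matrix.isUnit_iff_isUnit_det _).1 <|
    isUnit_of_ker _ fun v hv => (Q_pos hp A C hA hobs v).2 (by rw [hv, dotProduct_zero])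
  have hN : IsUnit (Nmat A B).det := (Matrix.isUnit_iff_isUnit_det _).1 <| by
    rw [Nmat_eq]
    exact isUnit_of_ker _ fun v hv =>
      (Q_pos hp Aᵀ Bᵀ hA.transpose hctrl v).2 (by rw [hv, dotProduct_zero])
  obtain ⟨X, hX, M1, hM1, ε1, hε1, h1⟩ := half_decay hp Aᵀ ((8 * t) • Aᵀ ^ 3) (Qmat A C) (Nmat A B)
    hA.transpose (((Commute.refl _).pow_right 3).smul_right _)
  obtain ⟨Y, hY, M2, hM2, ε2, hε2, h2⟩ := half_decay hp A (-((8 * t) • A ^ 3)) (Qmat A C)⁻¹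
    (Nmat A B)⁻¹ hA (((Commute.refl _).pow_right 3).smul_right _).neg_right
  refine combine (fun x => uFun A B C x t) hc (X := X) (Y := Y)
    (M1 := c * M1) (M2 := c * (‖(Nmat A B)⁻¹‖ * M2 * ‖(Qmat A C)⁻¹‖))
    hX hY (by positivity) (by positivity) hε1 hε2 ?_ ?_
  · intro x hx
    have h3 := h1 x hx (Fmat A B C x t)⁻¹ (by
      rw [← Matrix.mul_nonsing_inv _ (hFu x)]
      congr 1
      rw [F_eq]
      simp [Matrix.transpose_pow])
    show |phi B C (Fmat A B C x t)⁻¹| ≤ _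
    have h4 := hcb (Fmat A B C x t)⁻¹
    refine h4.trans ?_
    rw [mul_assoc]
    gcongr
  · intro x hx
    set F := Fmat A B C (-x) t with hF
    have hFe : NormedSpace.exp ((2 * x) • A - -((8 * t) • A ^ 3)) + (Qmat A C)⁻¹ *
        NormedSpace.exp (-((2 * x) • A - -((8 * t) • A ^ 3))ᵀ) * (Nmat A B)⁻¹
        = (Qmat A C)⁻¹ * F * (Nmat A B)⁻¹ := by
      have e1 : (2 * -x) • Aᵀ - (8 * t) • Aᵀ ^ 3 = -((2 * x) • A - -((8 * t) • A ^ 3))ᵀ := by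
        simp [Matrix.transpose_pow]; abel
      have e2 : -((2 * -x) • A - (8 * t) • A ^ 3) = (2 * x) • A - -((8 * t) • A ^ 3) := by
        simp [add_comm]
      rw [hF, F_eq, e1, e2, Matrix.mul_add, Matrix.add_mul, add_comm]
      congr 1
      rw [Matrix.mul_assoc, Matrix.mul_assoc, Matrix.mul_assoc, Matrix.mul_nonsing_inv _ hN,
        Matrix.mul_one, ← Matrix.mul_assoc, Matrix.nonsing_inv_mul _ hQ, Matrix.one_mul]
    have hG : (Qmat A C)⁻¹ * F * (Nmat A B)⁻¹ * (Nmat A B * F⁻¹ * Qmat A C) = 1 := by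
      calc _ = (Qmat A C)⁻¹ * (F * (((Nmat A B)⁻¹ * Nmat A B) * F⁻¹)) * Qmat A C := by
            simp only [Matrix.mul_assoc]
        _ = 1 := by
            rw [Matrix.nonsing_inv_mul _ hN, Matrix.one_mul, Matrix.mul_nonsing_inv _ (hFu (-x)),
              Matrix.mul_one, Matrix.nonsing_inv_mul _ hQ]
    have h3 := h2 x hx (Nmat A B * F⁻¹ * Qmat A C) (by rw [hFe, hG])
    have h5 : F⁻¹ = (Nmat A B)⁻¹ * (Nmat A B * F⁻¹ * Qmat A C) * (Qmat A C)⁻¹ := by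
      calc F⁻¹ = ((Nmat A B)⁻¹ * Nmat A B) * F⁻¹ * (Qmat A C * (Qmat A C)⁻¹) := by
            rw [Matrix.nonsing_inv_mul _ hN, Matrix.one_mul, Matrix.mul_nonsing_inv _ hQ,
              Matrix.mul_one]
        _ = _ := by simp only [Matrix.mul_assoc]
    show |phi B C F⁻¹| ≤ _
    have h4 := hcb F⁻¹
    refine h4.trans ?_
    rw [mul_assoc]
    gcongr
    rw [h5]
    calc _ ≤ ‖(Nmat A B)⁻¹‖ * ‖Nmat A B * F⁻¹ * Qmat A C‖ * ‖(Qmat A C)⁻¹‖ :=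
          (norm_mul_le _ _).trans (mul_le_mul_of_nonneg_right (norm_mul_le _ _) (norm_nonneg _))
      _ ≤ ‖(Nmat A B)⁻¹‖ * (M2 * Real.exp (-ε2 * x)) * ‖(Qmat A C)⁻¹‖ := by gcongr
      _ = _ := by ring
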